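/- arXiv:2104.11494 — 7 statements merged into one kernel-verified Lean document; each statement's English description precedes it below -/
import Mathlib

section
/- Under the stated assumptions (only parts (2) and (4) are needed), the length of the interval I_r = (μ_r((η_{r,1}+2δ_r) r), μ_r((η_{r,2}−2δ_r) r)) tends to +∞ as r → +∞; that is, μ_r((η_{r,2}−2δ_r) r) − μ_r((η_{r,1}+2δ_r) r) → +∞ as r → +∞. -/
open Set Filter

/-- Remark 1.3 of the paper: under parts (2) and (4) of Assumptions 1.1, the Lebesgue
measure of the interval `I_r = (μ_r((η_{r,1}+2δ_r) r), μ_r((η_{r,2}-2δ_r) r))` tends to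
`+∞` as `r → +∞`. -/
theorem interval_length_tendsto_atTop
    (r₀ : ℝ) (hr₀ : 0 < r₀)
    (η₁ η₂ δ : ℝ → ℝ)
    (hη : ∀ r ≥ r₀, 0 < η₁ r ∧ η₁ r < η₂ r)
    (hδ : ∀ r ≥ r₀, δ r ∈ Set.Ioo 0 ((η₂ r - η₁ r) / 5))
    (μ σ μ' : ℝ → ℝ → ℝ)
    -- Assumption (2):
    (μ_mono : ∀ r > r₀, StrictMonoOn (μ r) (Set.Icc (η₁ r * r) (η₂ r * r)))
    (σ_mono : ∀ r > r₀, StrictMonoOn (σ r) (Set.Icc (η₁ r * r) (η₂ r * r)))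
    (μ_deriv : ∀ r > r₀, ∀ x ∈ Set.Icc (η₁ r * r) (η₂ r * r), HasDerivAt (μ r) (μ' r x) x)
    (σ_diff : ∀ r > r₀, ∀ x ∈ Set.Icc (η₁ r * r) (η₂ r * r), DifferentiableAt ℝ (σ r) x)
    (μ_tendsto : Filter.Tendsto (fun r => μ r ((η₁ r + δ r) * r)) Filter.atTop Filter.atTop)
    (σ_tendsto : Filter.Tendsto (fun r => σ r ((η₁ r + δ r) * r)) Filter.atTop Filter.atTop)
    (xμ'_mono : ∀ r > r₀, MonotoneOn (fun x => x * μ' r x) (Set.Icc (η₁ r * r) (η₂ r * r)))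
    (inf_tendsto : ∀ K : ℝ, ∃ R : ℝ, ∀ r ≥ R,
      ∀ x ∈ Set.Ioo (η₁ r + δ r / 2) (η₂ r - δ r / 2),
        ∀ y ∈ Set.Ioo (η₁ r + δ r / 2) (η₂ r - δ r / 2),
          K ≤ δ r * r * μ' r (x * r) / (σ r (y * r)) ^ 2)
    -- Assumption (4):
    (bounded_away : ∃ c > 0, ∃ R : ℝ, ∀ r ≥ R,
      c ≤ η₁ r + δ r ∧ c ≤ η₂ r - η₁ r - 4 * δ r)
    (η₂_bounded : ∃ B : ℝ, ∃ R : ℝ, ∀ r ≥ R, η₂ r ≤ B) :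
    Filter.Tendsto
      (fun r => μ r ((η₂ r - 2 * δ r) * r) - μ r ((η₁ r + 2 * δ r) * r))
      Filter.atTop Filter.atTop := by
  rw [tendsto_atTop_atTop]
  intro K
  obtain ⟨R₁, hR₁⟩ := inf_tendsto (max K 0)
  obtain ⟨R₂, hR₂⟩ := tendsto_atTop_atTop.mp σ_tendsto 1
  refine ⟨max (r₀ + 1) (max R₁ R₂), fun r hr => ?_⟩
  obtain ⟨h₀, hr'⟩ := max_le_iff.mp hr
  obtain ⟨h₁, h₂⟩ := max_le_iff.mp hr'
  have hr_gt : r₀ < r := by linarith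
  have hr_pos : 0 < r := hr₀.trans hr_gt
  obtain ⟨hδ_pos, hδ_lt⟩ := hδ r hr_gt.le
  have hab : (η₁ r + 2 * δ r) * r < (η₂ r - 2 * δ r) * r :=
    mul_lt_mul_of_pos_right (by linarith) hr_pos
  have hsub : Icc ((η₁ r + 2 * δ r) * r) ((η₂ r - 2 * δ r) * r) ⊆
      Icc (η₁ r * r) (η₂ r * r) :=
    Icc_subset_Icc (mul_le_mul_of_nonneg_right (by linarith) hr_pos.le)
      (mul_le_mul_of_nonneg_right (by linarith) hr_pos.le)
  obtain ⟨ξ, hξ, hξ_eq⟩ := exists_hasDerivAt_eq_slope (μ r) (μ' r) hab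
    (fun x hx => (μ_deriv r hr_gt x (hsub hx)).continuousAt.continuousWithinAt)
    (fun x hx => μ_deriv r hr_gt x (hsub (Ioo_subset_Icc_self hx)))
  have hξ_left : η₁ r + 2 * δ r < ξ / r := (lt_div_iff₀ hr_pos).mpr hξ.1
  have hξ_right : ξ / r < η₂ r - 2 * δ r := (div_lt_iff₀ hr_pos).mpr hξ.2
  have hσ : 1 ≤ σ r ((η₁ r + δ r) * r) := hR₂ r h₂
  have hσ_sq : 1 ≤ σ r ((η₁ r + δ r) * r) ^ 2 := one_le_pow₀ hσ
  have hinf := hR₁ r h₁ (ξ / r) ⟨by linarith, by linarith⟩ (η₁ r + δ r)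
    ⟨by linarith, by linarith⟩
  rw [div_mul_cancel₀ _ hr_pos.ne', le_div_iff₀ (by linarith)] at hinf
  have hmax : max K 0 ≤ δ r * r * μ' r ξ :=
    (le_mul_of_one_le_right (le_max_right K 0) hσ_sq).trans hinf
  have hμ'_nonneg : 0 ≤ μ' r ξ :=
    nonneg_of_mul_nonneg_right ((le_max_right K 0).trans hmax) (mul_pos hδ_pos hr_pos)
  have hlen : δ r * r ≤ (η₂ r - 2 * δ r) * r - (η₁ r + 2 * δ r) * r := by
    rw [← sub_mul]
    exact mul_le_mul_of_nonneg_right (by linarith) hr_pos.le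
  rw [eq_div_iff (sub_pos.mpr hab).ne'] at hξ_eq
  calc K ≤ δ r * r * μ' r ξ := (le_max_left K 0).trans hmax
    _ ≤ ((η₂ r - 2 * δ r) * r - (η₁ r + 2 * δ r) * r) * μ' r ξ :=
      mul_le_mul_of_nonneg_right hlen hμ'_nonneg
    _ = μ r ((η₂ r - 2 * δ r) * r) - μ r ((η₁ r + 2 * δ r) * r) := by
      rw [mul_comm, hξ_eq]
end

section
/- For every z ∈ ℂ ∖ (−∞,0], the function g is complex differentiable at z with derivative g'(z) = √(z+a²)/(2z). (This identifies g, up to the piecewise constant ±πia/2, with the paper's g-function defined as the antiderivative ∫_{−a²}^{z} √(s+a²)/(2s) ds + sgn(Im z)·πia/2.) -/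
open Complex

/-- The `g`-function of the paper (for the hard-to-soft edge transition), defined using the
principal branches of the square root (`cpow (1/2)`) and the logarithm on `ℂ`:
`g(z) = √(z+a²) + a·Log(√z / (a + √(z+a²)))`. -/
noncomputable def gfun (a : ℝ) (z : ℂ) : ℂ :=
  (z + (a : ℂ) ^ 2) ^ (1 / 2 : ℂ) +
    (a : ℂ) * Complex.log (z ^ (1 / 2 : ℂ) / ((a : ℂ) + (z + (a : ℂ) ^ 2) ^ (1 / 2 : ℂ)))

/-- The principal square root of a point of the slit plane squares to that point. -/
theorem cpow_half_mul_self (w : ℂ) : w ^ (1 / 2 : ℂ) * w ^ (1 / 2 : ℂ) = w := by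
  have h := Complex.cpow_nat_inv_pow w (n := 2) two_ne_zero
  rw [pow_two] at h
  simpa [one_div] using h

/-- The principal square root maps the slit plane into the right half-plane. -/
theorem re_cpow_half_pos {w : ℂ} (hw : w ∈ slitPlane) : 0 < (w ^ (1 / 2 : ℂ)).re := by
  rw [cpow_def_of_ne_zero (slitPlane_ne_zero hw), exp_re]
  have him : (log w * (1 / 2 : ℂ)).im = arg w / 2 := by
    simp [mul_im, log_im, div_eq_mul_inv]
  rw [him]
  have hlt := lt_of_le_of_ne (arg_le_pi w) (slitPlane_arg_ne_pi hw)
  have hgt := neg_pi_lt_arg w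
  exact mul_pos (Real.exp_pos _) (Real.cos_pos_of_mem_Ioo ⟨by linarith, by linarith⟩)

/-- The derivative of the principal square root on the slit plane. -/
theorem hasDerivAt_cpow_half {w : ℂ} (hw : w ∈ slitPlane) :
    HasDerivAt (fun x : ℂ => x ^ (1 / 2 : ℂ)) (1 / (2 * w ^ (1 / 2 : ℂ))) w := by
  have h0 : w ^ (1 / 2 : ℂ) ≠ 0 := by
    simp [cpow_eq_zero_iff, slitPlane_ne_zero hw]
  refine ((hasDerivAt_id' w).cpow_const (c := (1 / 2 : ℂ)) hw).congr_deriv ?_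
  rw [cpow_sub _ _ (slitPlane_ne_zero hw), cpow_one]
  have hsq := cpow_half_mul_self w
  generalize w ^ (1 / 2 : ℂ) = r at *
  subst hsq
  field_simp

/-- A quotient of two points of the right half-plane lies in the slit plane. -/
theorem div_mem_slitPlane_of_re_pos {p q : ℂ} (hp : 0 < p.re) (hq : 0 < q.re) :
    p / q ∈ slitPlane := by
  have hq0 : q ≠ 0 := by
    rintro rfl
    simp at hq
  by_contra h
  rw [mem_slitPlane_iff, not_or, not_lt, not_not] at h
  have hpq : p.re = (p / q).re * q.re := by
    conv_lhs => rw [← div_mul_cancel₀ p hq0, mul_re, h.2]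
    ring
  nlinarith [mul_nonpos_of_nonpos_of_nonneg h.1 hq.le]

/-- Lemma 3.1 (analyticity of the `g`-function): for every `z` off the cut `(-∞,0]`,
`g` is complex differentiable at `z` with `g'(z) = √(z+a²)/(2z)`. -/
theorem gfun_hasDerivAt (a : ℝ) (ha : 0 < a) (z : ℂ)
    (hz : 0 < z.re ∨ z.im ≠ 0) :
    HasDerivAt (gfun a) ((z + (a : ℂ) ^ 2) ^ (1 / 2 : ℂ) / (2 * z)) z := by
  have hz' : z ∈ slitPlane := hz
  have hw : z + (a : ℂ) ^ 2 ∈ slitPlane := by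
    rw [← ofReal_pow, mem_slitPlane_iff, add_re, add_im, ofReal_re, ofReal_im, add_zero]
    exact hz.imp (fun h => by positivity) id
  have hp := hasDerivAt_cpow_half hz'
  have hs : HasDerivAt (fun x : ℂ => (x + (a : ℂ) ^ 2) ^ (1 / 2 : ℂ)) _ z :=
    (hasDerivAt_cpow_half hw).comp_add_const z ((a : ℂ) ^ 2)
  have hpre := re_cpow_half_pos hz'
  have hsre := re_cpow_half_pos hw
  have hpp := cpow_half_mul_self z
  have hss := cpow_half_mul_self (z + (a : ℂ) ^ 2)
  have hqre : 0 < ((a : ℂ) + (z + (a : ℂ) ^ 2) ^ (1 / 2 : ℂ)).re := by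
    rw [add_re, ofReal_re]
    positivity
  have ne_zero_of_re_pos : ∀ {w : ℂ}, 0 < w.re → w ≠ 0 := by
    rintro _ h rfl
    simp at h
  have hp0 := ne_zero_of_re_pos hpre
  have hs0 := ne_zero_of_re_pos hsre
  have hq0 := ne_zero_of_re_pos hqre
  have hg := hs.add (((hp.div (hs.const_add (a : ℂ)) hq0).clog
    (div_mem_slitPlane_of_re_pos hpre hqre)).const_mul (a : ℂ))
  refine hg.congr_deriv ?_
  simp only [Pi.div_apply]
  generalize (z + (a : ℂ) ^ 2) ^ (1 / 2 : ℂ) = s at *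
  generalize z ^ (1 / 2 : ℂ) = p at *
  subst hpp
  field_simp
  linear_combination -s * hss
end

section
/- For every real x < −a², the boundary values g₊(x) := lim_{y→0⁺} g(x+iy) and g₋(x) := lim_{y→0⁺} g(x−iy) exist and satisfy g₊(x) + g₋(x) = 0; equivalently, lim_{y→0⁺} Re g(x+iy) = 0 for every x < −a². -/
open Complex

open Filter Topology in
/-- Upper boundary value of the principal square root on the negative real axis. -/
theorem tendsto_cpow_half_add_mul_I {t : ℝ} (ht : t < 0) :
    Tendsto (fun y : ℝ => ((t : ℂ) + (y : ℂ) * I) ^ (1 / 2 : ℂ)) (𝓝[>] 0)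
      (𝓝 ((√(-t) : ℝ) * I)) := by
  have hz : Tendsto (fun y : ℝ => -((t : ℂ) + (y : ℂ) * I)) (𝓝[>] 0) (𝓝 ((-t : ℝ) : ℂ)) := by
    have h : Continuous fun y : ℝ => -((t : ℂ) + (y : ℂ) * I) := by fun_prop
    simpa using (h.tendsto 0).mono_left nhdsWithin_le_nhds
  have hs : ((-t : ℝ) : ℂ) ∈ slitPlane := by
    rw [ofReal_mem_slitPlane]; linarith
  have hlim := ((continuousAt_cpow_const (b := (1 / 2 : ℂ)) hs).tendsto.comp hz).mul_const I
  have hval : ((-t : ℝ) : ℂ) ^ (1 / 2 : ℂ) = (√(-t) : ℝ) := by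
    rw [Real.sqrt_eq_rpow, ofReal_cpow (by linarith)]
    norm_num
  rw [hval] at hlim
  refine hlim.congr' ?_
  filter_upwards [self_mem_nhdsWithin] with y hy
  have hy : 0 < y := hy
  have hne : (t : ℂ) + (y : ℂ) * I ≠ 0 := fun h => by
    have := congrArg im h
    simp at this
    linarith
  have hlog : log ((t : ℂ) + y * I) = log (-((t : ℂ) + y * I)) + Real.pi * I := by
    rw [log, log, norm_neg, arg_neg_eq_arg_sub_pi_of_im_pos (by simpa using hy)]
    push_cast
    ring
  simp only [Function.comp_apply]
  rw [cpow_def_of_ne_zero hne, cpow_def_of_ne_zero (neg_ne_zero.2 hne), hlog, add_mul,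
    exp_add, show (Real.pi : ℂ) * I * (1 / 2) = Real.pi / 2 * I by ring, exp_pi_div_two_mul_I]

open Filter Topology ComplexConjugate in
/-- Lower boundary value of the principal square root on the negative real axis. -/
theorem tendsto_cpow_half_sub_mul_I {t : ℝ} (ht : t < 0) :
    Tendsto (fun y : ℝ => ((t : ℂ) - (y : ℂ) * I) ^ (1 / 2 : ℂ)) (𝓝[>] 0)
      (𝓝 (-(√(-t) : ℝ) * I)) := by
  have hlim := (continuous_conj.tendsto _).comp (tendsto_cpow_half_add_mul_I ht)
  have hval : conj ((√(-t) : ℝ) * I) = -(√(-t) : ℝ) * I := by simp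
  rw [hval] at hlim
  refine hlim.congr' ?_
  filter_upwards [self_mem_nhdsWithin] with y hy
  have hy : 0 < y := hy
  have harg : arg ((t : ℂ) + y * I) ≠ Real.pi := fun h => by
    have := (arg_eq_pi_iff.1 h).2
    simp at this
    linarith
  have h := conj_cpow ((t : ℂ) + y * I) (1 / 2) harg
  have h2 : conj (1 / 2 : ℂ) = 1 / 2 := by rw [map_div₀, map_one, map_ofNat]
  have h3 : conj ((t : ℂ) + y * I) = t - y * I := by simp [sub_eq_add_neg]
  rw [h2, h3] at h
  exact h.symm

/-- On the imaginary axis, the argument of the logarithm in `gfun` has positive real part. -/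
theorem re_mul_I_div_add_mul_I_pos {a r s : ℝ} (ha : 0 < a) (h : 0 < r * s) :
    0 < ((s * I) / (a + r * I) : ℂ).re := by
  have hn : 0 < normSq ((a : ℂ) + r * I) := by
    rw [normSq_add_mul_I]
    positivity
  have hre : ((s * I) / (a + r * I) : ℂ).re = r * s / normSq ((a : ℂ) + r * I) := by
    rw [div_re]
    simp [mul_comm]
  rw [hre]
  exact div_pos h hn

open Filter Topology in
/-- If `√z` and `√(z + a²)` have limits `s * I` and `r * I` with `r`, `s` of the same sign,
then `gfun a` has the corresponding limit. -/
theorem tendsto_gfun_of_tendsto_cpow_half {α : Type*} {l : Filter α} {u : α → ℂ} {a r s : ℝ}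
    (ha : 0 < a) (h : 0 < r * s)
    (hs : Tendsto (fun y => u y ^ (1 / 2 : ℂ)) l (𝓝 (s * I)))
    (hr : Tendsto (fun y => (u y + (a : ℂ) ^ 2) ^ (1 / 2 : ℂ)) l (𝓝 (r * I))) :
    Tendsto (fun y => gfun a (u y)) l (𝓝 (r * I + a * log (s * I / (a + r * I)))) := by
  have hne : (a : ℂ) + r * I ≠ 0 := fun h0 => by
    have := congrArg re h0
    simp at this
    linarith
  exact hr.add (((hs.div (hr.const_add _) hne).clog
    (Or.inl (re_mul_I_div_add_mul_I_pos ha h))).const_mul _)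

/-- Property (3.2) of the `g`-function: for every real `x < -a²`, the boundary values
`g₊(x) = lim_{y→0⁺} g(x+iy)` and `g₋(x) = lim_{y→0⁺} g(x-iy)` exist and satisfy
`g₊(x) + g₋(x) = 0`. -/
theorem gfun_boundary_sum_zero (a : ℝ) (ha : 0 < a) (x : ℝ) (hx : x < -a ^ 2) :
    ∃ gp gm : ℂ,
      Filter.Tendsto (fun y : ℝ => gfun a ((x : ℂ) + (y : ℂ) * Complex.I))
        (nhdsWithin 0 (Set.Ioi 0)) (nhds gp) ∧
      Filter.Tendsto (fun y : ℝ => gfun a ((x : ℂ) - (y : ℂ) * Complex.I))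
        (nhdsWithin 0 (Set.Ioi 0)) (nhds gm) ∧
      gp + gm = 0 := by
  have hx0 : x < 0 := by nlinarith [sq_nonneg a]
  have hxa : x + a ^ 2 < 0 := by linarith
  set s := √(-x) with hs
  set r := √(-(x + a ^ 2)) with hr
  have hs0 : 0 < s := Real.sqrt_pos.2 (by linarith)
  have hr0 : 0 < r := Real.sqrt_pos.2 (by linarith)
  have hsr : s ^ 2 = a ^ 2 + r ^ 2 := by
    rw [hs, hr, Real.sq_sqrt (by linarith), Real.sq_sqrt (by linarith)]
    ring
  have hrs : 0 < r * s := mul_pos hr0 hs0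
  refine ⟨_, _, tendsto_gfun_of_tendsto_cpow_half (s := s) (r := r) ha hrs
      (tendsto_cpow_half_add_mul_I hx0) ?_,
    tendsto_gfun_of_tendsto_cpow_half (s := -s) (r := -r) ha (by linarith)
      (by simpa using tendsto_cpow_half_sub_mul_I hx0) ?_, ?_⟩
  · refine (tendsto_cpow_half_add_mul_I hxa).congr fun y => ?_
    push_cast
    ring_nf
  · have h := tendsto_cpow_half_sub_mul_I hxa
    rw [← ofReal_neg] at h
    refine h.congr fun y => ?_
    push_cast
    ring_nf
  · have hpos := re_mul_I_div_add_mul_I_pos ha hrs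
    have harg : arg (s * I / (a + r * I) : ℂ) ≠ Real.pi := fun h =>
      hpos.not_gt (arg_eq_pi_iff.1 h).1
    have hprod : ((-s : ℝ) * I / (a + (-r : ℝ) * I) : ℂ) = (s * I / (a + r * I))⁻¹ := by
      have h1 : (a : ℂ) + (-r : ℝ) * I ≠ 0 := fun h0 => by
        have := congrArg re h0
        simp at this
        linarith
      have h2 : (s : ℂ) * I ≠ 0 := by simp [hs0.ne']
      have hsr' : (s : ℂ) ^ 2 = a ^ 2 + r ^ 2 := by exact_mod_cast hsr
      rw [inv_div, div_eq_div_iff h1 h2]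
      push_cast
      linear_combination hsr' - ((s : ℂ) ^ 2 - r ^ 2) * I_sq
    rw [hprod, log_inv _ harg]
    push_cast
    ring
end

section
/- For every real x with −a² < x < 0, the boundary values g₊(x) := lim_{y→0⁺} g(x+iy) and g₋(x) := lim_{y→0⁺} g(x−iy) exist and satisfy g₊(x) − g₋(x) = πia. -/
open Complex

open Filter Topology in
/-- If `z → x` with `-a² < x < 0` along a filter on which `Log z → log (-x) + θ`, with
`exp (θ / 2) = e` off the real line, then `g z` converges. -/
lemma tendsto_gfun_of_tendsto_log {ι : Type*} {l : Filter ι} {f : ι → ℂ} {a x : ℝ} (ha : 0 < a)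
    (hx₁ : -a ^ 2 < x) (hx₂ : x < 0) {θ e : ℂ} (he : exp (θ / 2) = e) (him : e.im ≠ 0)
    (hf : Tendsto f l (𝓝 (x : ℂ)))
    (hlog : Tendsto (fun i => log (f i)) l (𝓝 ((Real.log (-x) : ℝ) + θ))) :
    Tendsto (fun i => gfun a (f i)) l
      (𝓝 ((√(x + a ^ 2) : ℝ) + (a : ℂ) *
        log ((Real.exp (Real.log (-x) / 2) / (a + √(x + a ^ 2)) : ℝ) * e))) := by
  have hpos : 0 < x + a ^ 2 := by linarith
  have hden : 0 < a + √(x + a ^ 2) := by positivity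
  have hne : ∀ᶠ i in l, f i ≠ 0 :=
    hf.eventually_ne (by exact_mod_cast hx₂.ne)
  have hsqrt : Tendsto (fun i => f i ^ (1 / 2 : ℂ)) l
      (𝓝 ((Real.exp (Real.log (-x) / 2) : ℝ) * e)) := by
    have h := (continuous_exp.tendsto _).comp (hlog.mul_const (1 / 2 : ℂ))
    have heq : exp (((Real.log (-x) : ℝ) + θ) * (1 / 2 : ℂ)) =
        (Real.exp (Real.log (-x) / 2) : ℝ) * e := by
      rw [← he, ofReal_exp, ← exp_add]
      congr 1
      push_cast
      ring
    rw [heq] at h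
    refine h.congr' ?_
    filter_upwards [hne] with i hi
    simp [cpow_def_of_ne_zero hi]
  have hsum : Tendsto (fun i => (f i + (a : ℂ) ^ 2) ^ (1 / 2 : ℂ)) l
      (𝓝 (√(x + a ^ 2) : ℝ)) := by
    have hval : ((√(x + a ^ 2) : ℝ) : ℂ) = ((x : ℂ) + (a : ℂ) ^ 2) ^ (1 / 2 : ℂ) := by
      rw [Real.sqrt_eq_rpow, ofReal_cpow hpos.le]
      push_cast
      rfl
    rw [hval]
    refine (hf.add_const _).cpow tendsto_const_nhds ?_
    exact_mod_cast ofReal_mem_slitPlane.2 hpos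
  have hquot : Tendsto
      (fun i => f i ^ (1 / 2 : ℂ) / ((a : ℂ) + (f i + (a : ℂ) ^ 2) ^ (1 / 2 : ℂ))) l
      (𝓝 ((Real.exp (Real.log (-x) / 2) / (a + √(x + a ^ 2)) : ℝ) * e)) := by
    have h := hsqrt.div (hsum.const_add (a : ℂ)) (by exact_mod_cast hden.ne')
    have heq : (Real.exp (Real.log (-x) / 2) : ℝ) * e / ((a : ℂ) + (√(x + a ^ 2) : ℝ)) =
        (Real.exp (Real.log (-x) / 2) / (a + √(x + a ^ 2)) : ℝ) * e := by
      push_cast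
      ring
    rwa [heq] at h
  refine hsum.add ((hquot.clog ?_).const_mul _)
  refine mem_slitPlane_iff.2 (Or.inr ?_)
  rw [im_ofReal_mul]
  exact mul_ne_zero (by positivity) him

/-- Property (3.3) of the `g`-function: for every real `x` with `-a² < x < 0`, the boundary
values `g₊(x) = lim_{y→0⁺} g(x+iy)` and `g₋(x) = lim_{y→0⁺} g(x-iy)` exist and satisfy
`g₊(x) - g₋(x) = πia`. -/
theorem gfun_boundary_jump (a : ℝ) (ha : 0 < a) (x : ℝ)
    (hx₁ : -a ^ 2 < x) (hx₂ : x < 0) :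
    ∃ gp gm : ℂ,
      Filter.Tendsto (fun y : ℝ => gfun a ((x : ℂ) + (y : ℂ) * Complex.I))
        (nhdsWithin 0 (Set.Ioi 0)) (nhds gp) ∧
      Filter.Tendsto (fun y : ℝ => gfun a ((x : ℂ) - (y : ℂ) * Complex.I))
        (nhdsWithin 0 (Set.Ioi 0)) (nhds gm) ∧
      gp - gm = (Real.pi : ℂ) * Complex.I * (a : ℂ) := by
  have hpos : 0 < Real.exp (Real.log (-x) / 2) / (a + √(x + a ^ 2)) := by positivity
  have hre : ((x : ℂ)).re < 0 := hx₂
  have hnorm : ‖(x : ℂ)‖ = -x := by rw [norm_real, Real.norm_of_nonpos hx₂.le]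
  have hp : Filter.Tendsto (fun y : ℝ => (x : ℂ) + (y : ℂ) * Complex.I)
      (nhdsWithin 0 (Set.Ioi 0)) (nhdsWithin (x : ℂ) {z : ℂ | 0 ≤ z.im}) := by
    refine tendsto_nhdsWithin_iff.2 ⟨?_, ?_⟩
    · exact ((by fun_prop : Continuous fun y : ℝ => (x : ℂ) + (y : ℂ) * Complex.I).tendsto'
        0 _ (by simp)).mono_left nhdsWithin_le_nhds
    · filter_upwards [self_mem_nhdsWithin] with y hy
      simpa using (Set.mem_Ioi.1 hy).le
  have hm : Filter.Tendsto (fun y : ℝ => (x : ℂ) - (y : ℂ) * Complex.I)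
      (nhdsWithin 0 (Set.Ioi 0)) (nhdsWithin (x : ℂ) {z : ℂ | z.im < 0}) := by
    refine tendsto_nhdsWithin_iff.2 ⟨?_, ?_⟩
    · exact ((by fun_prop : Continuous fun y : ℝ => (x : ℂ) - (y : ℂ) * Complex.I).tendsto'
        0 _ (by simp)).mono_left nhdsWithin_le_nhds
    · filter_upwards [self_mem_nhdsWithin] with y hy
      simpa using hy
  have hlogp := (tendsto_log_nhdsWithin_im_nonneg_of_re_neg_of_im_zero hre (ofReal_im x)).comp hp
  have hlogm := (tendsto_log_nhdsWithin_im_neg_of_re_neg_of_im_zero hre (ofReal_im x)).comp hm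
  rw [hnorm] at hlogp hlogm
  rw [sub_eq_add_neg] at hlogm
  have hexpp : exp (Real.pi * I / 2) = I := by
    rw [mul_div_right_comm, exp_pi_div_two_mul_I]
  have hexpm : exp (-(Real.pi * I) / 2) = -I := by
    rw [neg_div, exp_neg, hexpp, inv_I]
  refine ⟨_, _, tendsto_gfun_of_tendsto_log ha hx₁ hx₂ hexpp (by simp)
      (hp.mono_right nhdsWithin_le_nhds) hlogp,
    tendsto_gfun_of_tendsto_log ha hx₁ hx₂ hexpm (by simp)
      (hm.mono_right nhdsWithin_le_nhds) hlogm, ?_⟩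
  rw [log_ofReal_mul hpos I_ne_zero, log_ofReal_mul hpos (neg_ne_zero.2 I_ne_zero), log_I,
    log_neg_I]
  ring
end

section
/- For every real x with −a² < x < 0 one has √(x+a²) + a·log(√(−x)/(a+√(x+a²))) < 0. (This quantity is the common real part of the two boundary values of g at x, so it expresses that Re f(z) < 0 for z ∈ (−a²,0) in the notation of the paper, where f(z) = g(z) − sgn(Im z)·πia/2.) -/
open Complex

/-- The strict lower bound `2 t < log (1 + t) - log (1 - t)` for `0 < t < 1`. -/
theorem two_mul_lt_log_one_add_sub_log_one_sub {t : ℝ} (h₀ : 0 < t) (h₁ : t < 1) :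
    2 * t < Real.log (1 + t) - Real.log (1 - t) := by
  have hsum := Real.hasSum_log_sub_log_of_abs_lt_one (abs_lt.mpr ⟨by linarith, h₁⟩)
  have hle := sum_le_hasSum (Finset.range 2) (fun k _ => by positivity) hsum
  norm_num [Finset.sum_range_succ] at hle
  have : 0 < t ^ 3 := by positivity
  linarith

/-- Property (3.9) of the `g`-function (`Re f < 0` on `(-a²,0)`): for every real `x` with
`-a² < x < 0`, the common real part of the boundary values of `g` at `x`, namely
`√(x+a²) + a·log(√(-x)/(a+√(x+a²)))`, is negative. -/
theorem gfun_re_neg_on_band (a : ℝ) (ha : 0 < a) (x : ℝ)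
    (hx₁ : -a ^ 2 < x) (hx₂ : x < 0) :
    Real.sqrt (x + a ^ 2) +
      a * Real.log (Real.sqrt (-x) / (a + Real.sqrt (x + a ^ 2))) < 0 := by
  set s := Real.sqrt (x + a ^ 2)
  have hs₀ : 0 < s := Real.sqrt_pos.mpr (by linarith)
  have hsq : s ^ 2 = x + a ^ 2 := Real.sq_sqrt (by linarith)
  have hsa : s < a := by nlinarith
  have hlog : Real.log (Real.sqrt (-x) / (a + s)) =
      -(Real.log (1 + s / a) - Real.log (1 - s / a)) / 2 := by
    have hx : -x = (a - s) * (a + s) := by linear_combination hsq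
    have hadd : 1 + s / a = (a + s) / a := by field_simp
    have hsub : 1 - s / a = (a - s) / a := by field_simp
    have hp : a + s ≠ 0 := by positivity
    have hm : a - s ≠ 0 := (sub_pos.mpr hsa).ne'
    rw [Real.log_div (Real.sqrt_pos.mpr (by linarith)).ne' hp, Real.log_sqrt (by linarith), hx,
      Real.log_mul hm hp, hadd, hsub, Real.log_div hp ha.ne', Real.log_div hm ha.ne']
    ring
  have key := two_mul_lt_log_one_add_sub_log_one_sub (div_pos hs₀ ha) ((div_lt_one ha).mpr hsa)
  have hmul := mul_lt_mul_of_pos_left key ha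
  have hcancel : a * (2 * (s / a)) = 2 * s := by field_simp
  rw [hlog]
  linarith
end

section
/- For all reals 0 < x₁ < x₂ there exist constants C > 0 and a₀ ∈ (0, √x₁) such that for every a ∈ (0, a₀] and every x ∈ [x₁, x₂]: | ∫_{a²}^{x} √(u−a²)/(2u) du − ( √x − πa/2 ) | ≤ C·a². (This is the expansion μ_α(r x) = √(r x)/π − α/2 + O(a²√r) as a → 0, used to match the large-α Bessel asymptotics with the bounded-α regime.) -/
/-- For `0 < a` and `a² ≤ x`, integration of `√(u - a²) / (2u)` over `[a², x]` in closed form. -/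
theorem integral_sqrt_sub_sq_div {a x : ℝ} (ha : 0 < a) (hx : a ^ 2 ≤ x) :
    ∫ u in (a ^ 2)..x, Real.sqrt (u - a ^ 2) / (2 * u) =
      Real.sqrt (x - a ^ 2) - a * Real.arctan (Real.sqrt (x - a ^ 2) / a) := by
  have hpos : ∀ u ∈ Set.Icc (a ^ 2) x, 0 < u := fun u hu => (pow_pos ha 2).trans_le hu.1
  have key := intervalIntegral.integral_eq_sub_of_hasDerivAt_of_le
    (f := fun u => Real.sqrt (u - a ^ 2) - a * Real.arctan (Real.sqrt (u - a ^ 2) / a))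
    (f' := fun u => Real.sqrt (u - a ^ 2) / (2 * u)) hx (by fun_prop) ?_ ?_
  · simpa using key
  · intro u hu
    have hd : 0 < u - a ^ 2 := sub_pos.2 hu.1
    have hs : 0 < Real.sqrt (u - a ^ 2) := Real.sqrt_pos.2 hd
    have hsq : Real.sqrt (u - a ^ 2) ^ 2 = u - a ^ 2 := Real.sq_sqrt hd.le
    have h₁ := ((hasDerivAt_id u).sub_const (a ^ 2)).sqrt hd.ne'
    have h₂ := h₁.sub (((h₁.div_const a).arctan).const_mul a)
    refine h₂.congr_deriv ?_
    have hu₀ : 0 < u := hpos u ⟨hu.1.le, hu.2.le⟩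
    simp only [id]
    have hden : 1 + (Real.sqrt (u - a ^ 2) / a) ^ 2 = u / a ^ 2 := by
      rw [div_pow, hsq]
      field_simp
      ring
    rw [hden]
    field_simp
    linarith
  · refine ContinuousOn.intervalIntegrable_of_Icc hx (ContinuousOn.div (by fun_prop)
      (by fun_prop) fun u hu => ?_)
    have := hpos u hu
    positivity

/-- The inverse tangent of a nonnegative number is at most that number. -/
theorem arctan_le_self_of_nonneg {y : ℝ} (hy : 0 ≤ y) : Real.arctan y ≤ y := by
  simpa using Real.le_tan (Real.arctan_nonneg.2 hy) (Real.arctan_lt_pi_div_two y)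

/-- The expansion `μ_α(rx) = √(rx)/π - α/2 + O(a²√r)` as `a → 0` (first expansion in
(1.15) of the paper), in integral form: for `0 < x₁ < x₂` there are `C > 0` and
`a₀ ∈ (0, √x₁)` such that for all `a ∈ (0, a₀]` and all `x ∈ [x₁, x₂]`,
`|∫_{a²}^{x} √(u-a²)/(2u) du - (√x - πa/2)| ≤ C a²`. -/
theorem integral_mean_small_a_expansion (x₁ x₂ : ℝ) (hx₁ : 0 < x₁) (hx₁₂ : x₁ < x₂) :
    ∃ C > (0 : ℝ), ∃ a₀ ∈ Set.Ioo (0 : ℝ) (Real.sqrt x₁),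
      ∀ a ∈ Set.Ioc (0 : ℝ) a₀, ∀ x ∈ Set.Icc x₁ x₂,
        |(∫ u in (a ^ 2)..x, Real.sqrt (u - a ^ 2) / (2 * u)) -
            (Real.sqrt x - Real.pi * a / 2)| ≤ C * a ^ 2 := by
  have hq : 0 < Real.sqrt x₁ := Real.sqrt_pos.2 hx₁
  refine ⟨2 / Real.sqrt x₁, by positivity, Real.sqrt x₁ / 2, ⟨by positivity, by linarith⟩, ?_⟩
  rintro a ⟨ha, ha'⟩ x ⟨hx, -⟩
  have hqsq : Real.sqrt x₁ ^ 2 = x₁ := Real.sq_sqrt hx₁.le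
  have hax : a ^ 2 ≤ x₁ / 4 := by nlinarith
  rw [integral_sqrt_sub_sq_div ha (by linarith)]
  set q := Real.sqrt x₁
  set s := Real.sqrt (x - a ^ 2)
  have hs_low : q / 2 ≤ s := Real.le_sqrt_of_sq_le (by nlinarith)
  have hs_pos : 0 < s := by linarith
  have hs_sq : s ^ 2 = x - a ^ 2 := Real.sq_sqrt (by nlinarith)
  have hqx : q ≤ Real.sqrt x := Real.sqrt_le_sqrt hx
  have hx_sq : Real.sqrt x ^ 2 = x := Real.sq_sqrt (by linarith)
  have hsx : s ≤ Real.sqrt x := Real.sqrt_le_sqrt (by nlinarith)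
  have hdiff : Real.sqrt x - s ≤ 2 / q * a ^ 2 := by
    rw [div_mul_eq_mul_div, le_div_iff₀ hq]
    nlinarith
  have hinv : Real.arctan (s / a) = Real.pi / 2 - Real.arctan (a / s) := by
    rw [← Real.arctan_inv_of_pos (by positivity), inv_div]
  have harc : a * Real.arctan (a / s) ≤ 2 / q * a ^ 2 :=
    calc a * Real.arctan (a / s) ≤ a * (a / s) := by
          gcongr
          exact arctan_le_self_of_nonneg (by positivity)
      _ ≤ a * (a / (q / 2)) := by gcongr
      _ = 2 / q * a ^ 2 := by field_simp
  have harc₀ : 0 ≤ a * Real.arctan (a / s) :=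
    mul_nonneg ha.le (Real.arctan_nonneg.2 (by positivity))
  rw [hinv, abs_le]
  constructor <;> linarith
end

section
/- For all constants A > 0 and 0 < c < C with A² + c < C, there exist C' > 0 and r₀ > 0 such that for all r ≥ r₀, all a ∈ (0, A], α := a√r, and all ξ ∈ [α² + c r, C r]: | σ_α²(ξ) − (1/(2π²)) · log μ_α(ξ) | ≤ C'. (This verifies that the large-α Bessel process satisfies condition (σ_r² ∘ μ_r^{−1})(k) = (1/(2π²)) log k + O(1) in the rigidity assumptions.) -/
/-- `μ_α(ξ) = (1/π) ∫_{α²}^{ξ} √(u-α²)/(2u) du`, the mean of the counting function of the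
Bessel point process with parameter `α`. -/
noncomputable def besselMean (α ξ : ℝ) : ℝ :=
  (1 / Real.pi) * ∫ u in (α ^ 2)..ξ, Real.sqrt (u - α ^ 2) / (2 * u)

/-- `σ_α²(ξ) = (1/(2π²)) log(4(ξ-α²)^{3/2}/ξ)`, the variance function of the counting
statistics of the Bessel point process with parameter `α`. -/
noncomputable def besselVar (α ξ : ℝ) : ℝ :=
  1 / (2 * Real.pi ^ 2) * Real.log (4 * (ξ - α ^ 2) ^ ((3 : ℝ) / 2) / ξ)

/-- The integrand of `besselMean` is interval integrable when the lower endpoint is positive. -/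
theorem intervalIntegrable_sqrt_sub_div {s ξ : ℝ} (hs : 0 < s) (h : s ≤ ξ) :
    IntervalIntegrable (fun u => Real.sqrt (u - s) / (2 * u)) MeasureTheory.volume s ξ := by
  apply ContinuousOn.intervalIntegrable
  rw [Set.uIcc_of_le h]
  refine ContinuousOn.div (by fun_prop) (by fun_prop) fun u hu => ?_
  have : 0 < u := hs.trans_le hu.1
  positivity

theorem integral_sub_rpow {s ξ p : ℝ} (hp : -1 < p) :
    ∫ u in s..ξ, (u - s) ^ p = (ξ - s) ^ (p + 1) / (p + 1) := by
  rw [intervalIntegral.integral_comp_sub_right (fun u => u ^ p) s, integral_rpow (Or.inl hp),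
    sub_self, Real.zero_rpow (by linarith), sub_zero]

theorem intervalIntegrable_sub_rpow {s ξ p : ℝ} (hp : -1 < p) :
    IntervalIntegrable (fun u => (u - s) ^ p) MeasureTheory.volume s ξ := by
  have := (intervalIntegral.intervalIntegrable_rpow' (a := 0) (b := ξ - s) hp).comp_sub_right s
  simpa using this

theorem div_le_integral_sqrt_sub_div {s ξ : ℝ} (hs : 0 < s) (h : s ≤ ξ) :
    (ξ - s) ^ ((3 : ℝ) / 2) / ξ / 3 ≤ ∫ u in s..ξ, Real.sqrt (u - s) / (2 * u) := by
  have hint : ∫ u in s..ξ, 1 / (2 * ξ) * (u - s) ^ ((1 : ℝ) / 2) =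
      (ξ - s) ^ ((3 : ℝ) / 2) / ξ / 3 := by
    rw [intervalIntegral.integral_const_mul, integral_sub_rpow (by norm_num)]
    have : 0 < ξ := hs.trans_le h
    norm_num
    field_simp
  rw [← hint]
  refine intervalIntegral.integral_mono_on h
    ((intervalIntegrable_sub_rpow (by norm_num)).const_mul _)
    (intervalIntegrable_sqrt_sub_div hs h) fun u hu => ?_
  have hu0 : 0 < u := hs.trans_le hu.1
  rw [← Real.sqrt_eq_rpow, one_div_mul_eq_div]
  have := hu.2
  gcongr

theorem integral_sqrt_sub_div_le {s ξ : ℝ} (hs : 0 < s) (h : s ≤ ξ) :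
    ∫ u in s..ξ, Real.sqrt (u - s) / (2 * u) ≤ (ξ - s) ^ ((1 : ℝ) / 2) := by
  have hint : ∫ u in s..ξ, 1 / 2 * (u - s) ^ (-(1 : ℝ) / 2) = (ξ - s) ^ ((1 : ℝ) / 2) := by
    rw [intervalIntegral.integral_const_mul, integral_sub_rpow (by norm_num)]
    norm_num
    ring
  rw [← hint]
  refine intervalIntegral.integral_mono_on_of_le_Ioo h (intervalIntegrable_sqrt_sub_div hs h)
    ((intervalIntegrable_sub_rpow (by norm_num)).const_mul _) fun u hu => ?_
  have hu0 : 0 < u := hs.trans hu.1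
  have hus : 0 < u - s := sub_pos.2 hu.1
  have hsq : 0 < Real.sqrt (u - s) := Real.sqrt_pos.2 hus
  rw [neg_div, Real.rpow_neg hus.le, ← Real.sqrt_eq_rpow, ← one_div, div_mul_div_comm,
    div_le_div_iff₀ (by positivity) (by positivity)]
  nlinarith [Real.mul_self_sqrt hus.le]

/-- Verification of assumption (3) of the rigidity theorem for the large-`α` Bessel
process: `σ_α²(ξ) = (1/(2π²)) log μ_α(ξ) + O(1)` uniformly for `α = a√r` with
`a ∈ (0, A]` and `ξ ∈ [α² + cr, Cr]`. -/
theorem besselVar_eq_log_besselMean_add_O_one (A c C : ℝ)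
    (hA : 0 < A) (hc : 0 < c) (hcC : c < C) (hAC : A ^ 2 + c < C) :
    ∃ C' > (0 : ℝ), ∃ r₀ > (0 : ℝ), ∀ r ≥ r₀, ∀ a ∈ Set.Ioc (0 : ℝ) A,
      ∀ ξ ∈ Set.Icc ((a * Real.sqrt r) ^ 2 + c * r) (C * r),
        |besselVar (a * Real.sqrt r) ξ -
            1 / (2 * Real.pi ^ 2) * Real.log (besselMean (a * Real.sqrt r) ξ)| ≤ C' := by
  have hπ := Real.pi_pos
  have hC : 0 < C := hc.trans hcC
  set B := |Real.log (4 * Real.pi * (c / C))| + |Real.log (12 * Real.pi)|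
  refine ⟨1 / (2 * Real.pi ^ 2) * B + 1, by positivity, 1, one_pos, ?_⟩
  rintro r hr a ⟨ha, -⟩ ξ ⟨hξ₁, hξ₂⟩
  have hr0 : 0 < r := one_pos.trans_le hr
  unfold besselVar besselMean
  have hs : 0 < (a * Real.sqrt r) ^ 2 := by positivity
  set s := (a * Real.sqrt r) ^ 2
  have hcr : 0 < c * r := by positivity
  have hD : 0 < ξ - s := by linarith
  have hξ : 0 < ξ := by linarith
  have hsξ : s ≤ ξ := by linarith
  have hlow := div_le_integral_sqrt_sub_div hs hsξ
  have hupp := integral_sqrt_sub_div_le hs hsξ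
  set I := ∫ u in s..ξ, Real.sqrt (u - s) / (2 * u)
  have hpow : (ξ - s) ^ ((3 : ℝ) / 2) = (ξ - s) ^ ((1 : ℝ) / 2) * (ξ - s) := by
    rw [← Real.rpow_add_one hD.ne']
    norm_num
  set M := (ξ - s) ^ ((3 : ℝ) / 2) / ξ with hM
  have hM0 : 0 < M := by positivity
  have hI0 : 0 < I := by linarith
  have hratio : c / C ≤ (ξ - s) / ξ := by
    rw [div_le_div_iff₀ hC hξ]
    nlinarith
  have hIM : c / C * I ≤ M := by
    calc c / C * I ≤ (ξ - s) / ξ * (ξ - s) ^ ((1 : ℝ) / 2) := by gcongr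
      _ = M := by rw [hM, hpow]; ring
  have hlog : Real.log (4 * (ξ - s) ^ ((3 : ℝ) / 2) / ξ) - Real.log (1 / Real.pi * I) =
      Real.log (4 * Real.pi * (M / I)) := by
    rw [← Real.log_div (by positivity) (by positivity), hM]
    congr 1
    field_simp
  rw [← mul_sub, hlog, abs_mul, abs_of_pos (by positivity : 0 < 1 / (2 * Real.pi ^ 2))]
  have h₁ : Real.log (4 * Real.pi * (c / C)) ≤ Real.log (4 * Real.pi * (M / I)) := by
    apply Real.log_le_log (by positivity)
    exact mul_le_mul_of_nonneg_left ((le_div_iff₀ hI0).2 hIM) (by positivity)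
  have h₂ : Real.log (4 * Real.pi * (M / I)) ≤ Real.log (12 * Real.pi) := by
    apply Real.log_le_log (by positivity)
    have : M / I ≤ 3 := by
      rw [div_le_iff₀ hI0]
      linarith
    nlinarith
  have hB : |Real.log (4 * Real.pi * (M / I))| ≤ B :=
    (abs_le_max_abs_abs h₁ h₂).trans
      (max_le (le_add_of_nonneg_right (abs_nonneg _)) (le_add_of_nonneg_left (abs_nonneg _)))
  have := mul_le_mul_of_nonneg_left hB (by positivity : 0 ≤ 1 / (2 * Real.pi ^ 2))
  linarith
end
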